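/- A connected bipartite graph in which every edge lies in some perfect matching (i.e., an elementary bipartite graph) with more than two vertices is 2-connected. -/

import Mathlib

open SimpleGraph

theorem aux_even {V : Type} [DecidableEq V] {G : SimpleGraph V} (M : G.Subgraph)
    (hM : M.IsPerfectMatching) (S : Finset V)
    (hS : ∀ x ∈ S, ∀ y, M.Adj x y → y ∈ S) : Even S.card := by
  rw [Subgraph.isPerfectMatching_iff] at hM
  choose f hf hu using hM
  have h : ∑ x ∈ S, (1 : ZMod 2) = 0 := by
    refine Finset.sum_involution (fun x _ => f x) ?_ ?_ ?_ ?_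
    · intros; decide
    · intro x _ _ h
      have := hf x
      simp only [h] at this
      exact M.loopless.irrefl x this
    · intro x hx
      exact hS x hx _ (hf x)
    · intro x hx
      exact (hu (f x) x (hf x).symm).symm
  simp only [Finset.sum_const, nsmul_eq_mul, mul_one] at h
  exact (ZMod.natCast_eq_zero_iff_even).1 h

theorem aux_key {V : Type} [Fintype V] [DecidableEq V] {G : SimpleGraph V}
    (hconn : G.Connected)
    (hel : ∀ e ∈ G.edgeSet, ∃ M : G.Subgraph, M.IsPerfectMatching ∧ e ∈ M.edgeSet)
    (v : V) (S : Finset V) (hv : v ∉ S) (hne : S.Nonempty)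
    (hcl : ∀ x ∈ S, ∀ y, G.Adj x y → y ≠ v → y ∈ S)
    (M : G.Subgraph) (hM : M.IsPerfectMatching) (w : V) (hw : M.Adj v w) (hwS : w ∉ S) :
    False := by
  have e1 : Even S.card := by
    refine aux_even M hM S fun x hx y hxy => hcl x hx y hxy.adj_sub ?_
    rintro rfl
    obtain ⟨z, _, hz⟩ := Subgraph.isPerfectMatching_iff.1 hM y
    exact hwS ((hz w hw).trans (hz x hxy.symm).symm ▸ hx)
  obtain ⟨u, hu, huv⟩ : ∃ u ∈ S, G.Adj v u := by
    by_contra! hno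
    obtain ⟨a, ha⟩ := hne
    obtain ⟨p⟩ := hconn.preconnected a v
    have : ∀ (x y : V) (p : G.Walk x y), x ∈ S → y ∈ S := by
      intro x y p
      induction p with
      | nil => exact id
      | cons h p ih =>
        intro hx
        refine ih (hcl _ hx _ h ?_)
        rintro rfl
        exact hno _ hx h.symm
    exact hv (this a v p ha)
  obtain ⟨M', hM', he⟩ := hel s(v, u) huv
  have he : M'.Adj v u := he
  have uniq := Subgraph.isPerfectMatching_iff.1 hM'
  have e2 : Even (S.erase u).card := by
    refine aux_even M' hM' _ fun x hx y hxy => ?_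
    obtain ⟨hxu, hxS⟩ := Finset.mem_erase.1 hx
    refine Finset.mem_erase.2 ⟨?_, hcl x hxS y hxy.adj_sub ?_⟩
    · rintro rfl
      have : x = v := (uniq y).unique hxy.symm he.symm
      exact hv (this ▸ hxS)
    · rintro rfl
      exact hxu ((uniq y).unique hxy.symm he)
  have := Finset.card_erase_add_one hu
  grind

/-- A connected bipartite graph with more than two vertices in which every edge lies in
some perfect matching (an elementary bipartite graph) is 2-connected: connected, with at
least 3 vertices, and with no cut vertex. -/
theorem stmt13 {V : Type} [Fintype V] [DecidableEq V] {G : SimpleGraph V}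
    (hconn : G.Connected) (hbip : G.Colorable 2)
    (hpm : ∃ M : G.Subgraph, M.IsPerfectMatching)
    (hel : ∀ e ∈ G.edgeSet, ∃ M : G.Subgraph, M.IsPerfectMatching ∧ e ∈ M.edgeSet)
    (hcard : 2 < Fintype.card V) :
    G.Connected ∧ 3 ≤ Fintype.card V ∧
      ∀ v : V, (G.induce ({v}ᶜ : Set V)).Connected := by
  classical
  refine ⟨hconn, hcard, fun v => ?_⟩
  obtain ⟨M, hM⟩ := hpm
  obtain ⟨w, hw, -⟩ := Subgraph.isPerfectMatching_iff.1 hM v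
  have hwv : w ≠ v := hw.adj_sub.ne'
  haveI : Nonempty ({v}ᶜ : Set V) := ⟨⟨w, hwv⟩⟩
  refine ⟨fun a b => ?_⟩
  by_contra hab
  set H := G.induce ({v}ᶜ : Set V) with hH
  by_cases hwS : ∃ h : w ∈ ({v}ᶜ : Set V), H.Reachable a ⟨w, h⟩
  · refine aux_key hconn hel v
      (Finset.univ.filter fun x => ∃ h : x ∈ ({v}ᶜ : Set V), ¬ H.Reachable a ⟨x, h⟩)
      ?_ ⟨b, ?_⟩ ?_ M hM w hw ?_
    · simp
    · simp only [Finset.mem_filter, Finset.mem_univ, true_and]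
      exact ⟨b.2, hab⟩
    · intro x hx y hxy hy
      simp only [Finset.mem_filter, Finset.mem_univ, true_and] at hx ⊢
      obtain ⟨h, hr⟩ := hx
      refine ⟨hy, fun h' => hr (h'.trans (Adj.reachable ?_))⟩
      exact hxy.symm
    · simp only [Finset.mem_filter, Finset.mem_univ, true_and]
      rintro ⟨h, hr⟩
      exact hr hwS.2
  · refine aux_key hconn hel v
      (Finset.univ.filter fun x => ∃ h : x ∈ ({v}ᶜ : Set V), H.Reachable a ⟨x, h⟩)
      ?_ ⟨a, ?_⟩ ?_ M hM w hw ?_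
    · simp
    · simp only [Finset.mem_filter, Finset.mem_univ, true_and]
      exact ⟨a.2, Reachable.refl _⟩
    · intro x hx y hxy hy
      simp only [Finset.mem_filter, Finset.mem_univ, true_and] at hx ⊢
      obtain ⟨h, hr⟩ := hx
      refine ⟨hy, hr.trans (Adj.reachable ?_)⟩
      exact hxy
    · simpa only [Finset.mem_filter, Finset.mem_univ, true_and] using hwS
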